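/- Let Γ' be a finite simple graph on vertex set V with an edge e joining distinct vertices a and b, and suppose that every Hamiltonian cycle of Γ' traverses the edge e. Let Γ be the simple graph on vertex set V ⊔ {u, v} (the disjoint union of V with two new vertices u and v) whose edges are all edges of Γ' except e, together with the two new edges {a, u} and {b, v}. Then Γ contains a Hamiltonian path if and only if Γ' contains a Hamiltonian cycle. -/

import Mathlib

open SimpleGraph

namespace SimpleGraph.Walk

variable {V W : Type*} {G : SimpleGraph V} {H : SimpleGraph W}

/-- A vertex of a path all of whose neighbours coincide is an end of the path. -/
lemma IsPath.eq_or_eq_of_forall_adj {s t x y : V} {p : G.Walk s t} (hp : p.IsPath)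
    (hx : x ∈ p.support) (hxy : ∀ z, G.Adj x z → z = y) : x = s ∨ x = t := by
  obtain ⟨i, rfl, hi⟩ := mem_support_iff_exists_getVert.mp hx
  by_contra! hne
  have h0 : i ≠ 0 := by rintro rfl; simp at hne
  have hl : i < p.length := hi.lt_of_ne (by rintro rfl; simp at hne)
  have h2 := hp.ncard_neighborSet_toSubgraph_internal_eq_two h0 hl
  have hsub : p.toSubgraph.neighborSet (p.getVert i) ⊆ {y} :=
    fun z hz ↦ hxy z (p.toSubgraph.adj_sub hz)
  have := Set.ncard_le_ncard hsub
  simp [h2] at this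

/-- A walk whose vertices all lie in the range of `f` pulls back along `f`. -/
lemma exists_support_map_eq {f : W → V} (hf : f.Injective)
    (hadj : ∀ x y, G.Adj (f x) (f y) → H.Adj x y) {s t : V} (p : G.Walk s t)
    (hp : ∀ z ∈ p.support, z ∈ Set.range f) {x y : W} (hx : f x = s) (hy : f y = t) :
    ∃ q : H.Walk x y, q.support.map f = p.support := by
  induction p generalizing x with
  | nil =>
    obtain rfl := hf (hx.trans hy.symm)
    exact ⟨nil, by simp [hx]⟩
  | cons h p ih =>
    rw [support_cons, List.forall_mem_cons] at hp
    obtain ⟨z, rfl⟩ := hp.2 _ p.start_mem_support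
    subst hx
    obtain ⟨q, hq⟩ := ih hp.2 rfl hy
    exact ⟨cons (hadj _ _ h) q, by simp [hq]⟩

variable [Fintype V] [DecidableEq V]

lemma IsHamiltonianCycle.reverse {x : V} {c : G.Walk x x} (hc : c.IsHamiltonianCycle) :
    c.reverse.IsHamiltonianCycle := by
  rw [isHamiltonianCycle_iff_isCycle_and_length_eq] at hc ⊢
  exact ⟨hc.1.reverse, by simpa using hc.2⟩

/-- A Hamiltonian cycle through the edge `ab` can be traversed so that it starts with `ab`. -/
lemma IsHamiltonianCycle.exists_snd_eq {x a b : V} {c : G.Walk x x} (hc : c.IsHamiltonianCycle)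
    (he : s(a, b) ∈ c.edges) : ∃ d : G.Walk a a, d.IsHamiltonianCycle ∧ d.snd = b := by
  have ha := hc.mem_support a
  have hr := hc.rotate ha
  have hb : b ∈ (c.rotate a ha).toSubgraph.neighborSet a := by
    rw [Subgraph.mem_neighborSet, adj_toSubgraph_iff_mem_edges]
    exact (c.rotate_edges a ha).mem_iff.mpr he
  rw [hr.isCycle.neighborSet_toSubgraph_endpoint] at hb
  obtain hb | hb := hb
  · exact ⟨_, hr, hb.symm⟩
  · exact ⟨_, hr.reverse, by rw [snd_reverse]; exact hb.symm⟩

end SimpleGraph.Walk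

namespace SimpleGraph

variable {V : Type*} [Fintype V] [DecidableEq V] {G : SimpleGraph V} {a b : V}

/-- An edge lies on a Hamiltonian cycle iff deleting it leaves a Hamiltonian path between
its ends. -/
lemma exists_isHamiltonianCycle_mem_edges_iff (hab : G.Adj a b) :
    (∃ (x : V) (c : G.Walk x x), c.IsHamiltonianCycle ∧ s(a, b) ∈ c.edges) ↔
      ∃ p : (G.deleteEdges {s(a, b)}).Walk b a, p.IsHamiltonian := by
  constructor
  · rintro ⟨x, c, hc, he⟩
    obtain ⟨d, hd, hb⟩ := hc.exists_snd_eq he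
    cases d with
    | nil => exact absurd hd.isCycle Walk.not_isCycle_nil
    | cons h q =>
      obtain rfl : _ = b := by simpa using hb
      have hq := (Walk.cons_isCycle_iff q h).mp hd.isCycle
      refine ⟨q.toDeleteEdge _ hq.2, ?_⟩
      have := hd.isHamiltonian_tail
      intro z
      simpa using this z
  · rintro ⟨p, hp⟩
    have hle : G.deleteEdges {s(a, b)} ≤ G := deleteEdges_le _
    have hne : s(a, b) ∉ (p.mapLe hle).edges := by
      intro h
      rw [Walk.edges_mapLe_eq_edges] at h
      simpa using p.edges_subset_edgeSet h
    refine ⟨a, .cons hab (p.mapLe hle), ⟨?_, ?_⟩, by simp⟩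
    · exact (Walk.cons_isCycle_iff _ _).mpr ⟨hp.isPath.mapLe hle, hne⟩
    · intro z
      simpa using hp z

end SimpleGraph

/-- Let `Γ'` be a finite simple graph with an edge `e = {a,b}` lying on every
Hamiltonian cycle.  Replacing `e` by two pendant edges `{a,u}`, `{b,v}` with
new degree-one vertices `u, v` yields a graph `Γ` which has a Hamiltonian path
iff `Γ'` has a Hamiltonian cycle. -/
theorem hamiltonianPath_iff_hamiltonianCycle {V : Type*} [Fintype V] [DecidableEq V]
    (Γ' : SimpleGraph V) (a b : V) (hab : Γ'.Adj a b)
    (he : ∀ (v : V) (c : Γ'.Walk v v), c.IsHamiltonianCycle → s(a, b) ∈ c.edges)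
    (Γ : SimpleGraph (V ⊕ Fin 2))
    (hΓ : ∀ x y : V ⊕ Fin 2, Γ.Adj x y ↔
      ((∃ x' y' : V, x = Sum.inl x' ∧ y = Sum.inl y' ∧ Γ'.Adj x' y' ∧
          s(x', y') ≠ s(a, b)) ∨
        (x = Sum.inl a ∧ y = Sum.inr 0) ∨ (x = Sum.inr 0 ∧ y = Sum.inl a) ∨
        (x = Sum.inl b ∧ y = Sum.inr 1) ∨ (x = Sum.inr 1 ∧ y = Sum.inl b))) :
    (∃ (s t : V ⊕ Fin 2) (p : Γ.Walk s t), p.IsPath ∧ p.IsHamiltonian)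
      ↔ ∃ (v : V) (c : Γ'.Walk v v), c.IsHamiltonianCycle := by
  set H := Γ'.deleteEdges {s(a, b)} with hH
  have hll : ∀ x y : V, Γ.Adj (.inl x) (.inl y) ↔ H.Adj x y := fun x y ↦ by
    simp [hΓ, hH]
  have hu : ∀ z, Γ.Adj (.inr 0) z ↔ z = .inl a := fun z ↦ by simp [hΓ]
  have hv : ∀ z, Γ.Adj (.inr 1) z ↔ z = .inl b := fun z ↦ by simp [hΓ]
  have hcyc : (∃ (x : V) (c : Γ'.Walk x x), c.IsHamiltonianCycle) ↔
      ∃ p : H.Walk b a, p.IsHamiltonian := by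
    rw [← exists_isHamiltonianCycle_mem_edges_iff hab]
    exact exists₂_congr fun x c ↦ (and_iff_left_of_imp (he x c)).symm
  rw [hcyc]
  constructor
  · rintro ⟨s, t, p, hp, hham⟩
    obtain ⟨p, hp⟩ : ∃ p : Γ.Walk (.inr 1) (.inr 0), p.IsHamiltonian := by
      have h0 := hp.eq_or_eq_of_forall_adj (hham.mem_support (.inr 0)) fun z ↦ (hu z).mp
      have h1 := hp.eq_or_eq_of_forall_adj (hham.mem_support (.inr 1)) fun z ↦ (hv z).mp
      rcases h0 with rfl | rfl <;> rcases h1 with h1 | h1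
      · simp at h1
      · subst h1
        exact ⟨p.reverse, fun z ↦ by simpa using hham z⟩
      · subst h1
        exact ⟨p, hham⟩
      · simp at h1
    cases p with
    | cons h q =>
    obtain rfl := (hv _).mp h
    obtain ⟨w, r, h', rfl⟩ : ∃ w, ∃ (r : Γ.Walk (.inl b) w) (h' : Γ.Adj w (.inr 0)),
        q = r.concat h' := by
      cases q with
      | cons h₁ q₁ =>
        obtain ⟨w, r, h', e⟩ := Walk.exists_cons_eq_concat h₁ q₁
        exact ⟨w, r, h', e⟩
    obtain rfl := (hu _).mp h'.symm
    have hr := hp.isPath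
    rw [Walk.cons_isPath_iff, Walk.concat_isPath_iff] at hr
    obtain ⟨⟨hr, hr0⟩, hr1⟩ := hr
    rw [Walk.support_concat] at hr1
    have hrange : ∀ z ∈ r.support, z ∈ Set.range (Sum.inl : V → V ⊕ Fin 2) := by
      rintro (z | i) hz
      · exact ⟨z, rfl⟩
      · fin_cases i
        · exact absurd hz hr0
        · exact absurd (List.mem_append_left _ hz) hr1
    obtain ⟨q, hq⟩ := r.exists_support_map_eq Sum.inl_injective (fun x y ↦ (hll x y).mp) hrange
      rfl rfl
    have hqp : q.IsPath := .mk' (.of_map Sum.inl (hq ▸ hr.support_nodup))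
    refine ⟨q, hqp.isHamiltonian_of_mem fun z ↦ ?_⟩
    have hz := hp.mem_support (.inl z)
    simp only [Walk.support_cons, Walk.support_concat, ← hq] at hz
    simpa using hz
  · rintro ⟨q, hq⟩
    let f : H →g Γ := ⟨Sum.inl, fun h ↦ (hll _ _).mpr h⟩
    have hf : Function.Injective f := Sum.inl_injective
    let p : Γ.Walk (.inr 1) (.inr 0) :=
      .cons ((hv _).mpr rfl) ((q.map f).concat ((hu _).mpr rfl).symm)
    have hp : p.IsPath := by
      rw [Walk.cons_isPath_iff, Walk.concat_isPath_iff, Walk.support_concat]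
      refine ⟨⟨hq.isPath.map hf, ?_⟩, ?_⟩ <;> simp [f]
    refine ⟨_, _, p, hp, hp.isHamiltonian_of_mem ?_⟩
    rintro (z | i)
    · simp [p, f, Walk.support_concat, hq.mem_support]
    · fin_cases i <;> simp [p, Walk.support_concat]
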